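/- arXiv:1806.08683 — 2 statements merged into one kernel-verified Lean document; each statement's English description precedes it below -/
import Mathlib

section
/- Let z₁, …, z_n ∈ ℂ^{k-1} be unit vectors (k ≥ 3) and set J = (1/n) Σ_{i=1}^n z_i z_i*. If the smallest eigenvalue of the Hermitian matrix J is simple, with unit eigenvector m, then the maximizers over unit vectors u ∈ ℂ^{k-1} of the empirical Fréchet function F_n(u) = (1/n) Σ_{i=1}^n ‖z_i z_i* − uu*‖_F² are exactly the vectors of the form cm with |c| = 1; that is, the sample VW antimean is the projective point [m]. -/
open Matrix

/-- Squared Frobenius (Hilbert–Schmidt) norm of a complex matrix. -/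
noncomputable def frobSq {n : ℕ} (M : Matrix (Fin n) (Fin n) ℂ) : ℝ :=
  ∑ i, ∑ j, ‖M i j‖ ^ 2

/-- The Veronese–Whitney image `z z*` of a vector `z ∈ ℂⁿ`. -/
noncomputable def vwC {n : ℕ} (z : Fin n → ℂ) : Matrix (Fin n) (Fin n) ℂ :=
  vecMulVec z (star z)

theorem frobSq_vwC {n : ℕ} (z : Fin n → ℂ) :
    frobSq (vwC z) = (∑ i, ‖z i‖ ^ 2) ^ 2 := by
  simp only [frobSq, vwC, vecMulVec_apply, Pi.star_apply, norm_mul, norm_star, mul_pow]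
  rw [sq, Finset.sum_mul_sum]

theorem frobSq_sub {n : ℕ} (M N : Matrix (Fin n) (Fin n) ℂ) :
    frobSq (M - N) = frobSq M + frobSq N - 2 * ∑ i, ∑ j, (M i j * star (N i j)).re := by
  simp only [frobSq, Finset.mul_sum, ← Finset.sum_add_distrib, ← Finset.sum_sub_distrib]
  refine Finset.sum_congr rfl fun i _ => Finset.sum_congr rfl fun j _ => ?_
  simp only [← Complex.normSq_eq_norm_sq, Matrix.sub_apply, Complex.normSq_sub]
  rfl

theorem sum_re_mul_star_vwC {n : ℕ} (M : Matrix (Fin n) (Fin n) ℂ) (u : Fin n → ℂ) :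
    ∑ i, ∑ j, (M i j * star (vwC u i j)).re = (star u ⬝ᵥ M *ᵥ u).re := by
  simp only [dotProduct, mulVec, Finset.mul_sum, Complex.re_sum]
  refine Finset.sum_congr rfl fun i _ => Finset.sum_congr rfl fun j _ => ?_
  congr 1
  simp only [vwC, vecMulVec_apply, Pi.star_apply, star_mul, star_star]
  ring

theorem star_dotProduct_self {n : ℕ} (u : Fin n → ℂ) :
    star u ⬝ᵥ u = ((∑ i, ‖u i‖ ^ 2 : ℝ) : ℂ) := by
  simp [dotProduct, Complex.conj_mul']

theorem frechet_eq {n d : ℕ} (hn : 0 < n) (z : Fin n → Fin d → ℂ)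
    (hz : ∀ r, ∑ i, ‖z r i‖ ^ 2 = 1) (u : Fin d → ℂ) (hu : ∑ i, ‖u i‖ ^ 2 = 1) :
    (n : ℝ)⁻¹ * ∑ r, frobSq (vwC (z r) - vwC u) =
      2 - 2 * (star u ⬝ᵥ ((n : ℂ)⁻¹ • ∑ r, vwC (z r)) *ᵥ u).re := by
  have hn' : (n : ℝ) ≠ 0 := by positivity
  have hcast : (n : ℂ)⁻¹ = (((n : ℝ)⁻¹ : ℝ) : ℂ) := by push_cast; rfl
  simp only [frobSq_sub, frobSq_vwC, hz, hu, sum_re_mul_star_vwC, smul_mulVec, dotProduct_smul,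
    sum_mulVec, dotProduct_sum, smul_eq_mul, hcast, Complex.re_ofReal_mul, Complex.re_sum,
    Finset.sum_sub_distrib, ← Finset.mul_sum, Finset.sum_const, Finset.card_univ,
    Fintype.card_fin, nsmul_eq_mul]
  field_simp
  ring

open scoped ComplexOrder in
/-- Subtracting a lower bound for the eigenvalues of a Hermitian matrix leaves a positive
semidefinite matrix. -/
theorem posSemidef_sub_smul_one {d : ℕ} {J : Matrix (Fin d) (Fin d) ℂ} (hJ : J.IsHermitian)
    {lam : ℝ} (hmin : ∀ mu : ℝ, (∃ w, w ≠ 0 ∧ J *ᵥ w = (mu : ℂ) • w) → lam ≤ mu) :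
    (J - (lam : ℂ) • (1 : Matrix (Fin d) (Fin d) ℂ)).PosSemidef := by
  have hA : (J - (lam : ℂ) • (1 : Matrix (Fin d) (Fin d) ℂ)).IsHermitian := by
    refine hJ.sub ?_
    simp [IsHermitian, conjTranspose_smul]
  refine hA.posSemidef_iff_eigenvalues_nonneg.2 fun i => ?_
  have hev := hA.mulVec_eigenvectorBasis i
  have hne : (hA.eigenvectorBasis i).ofLp ≠ 0 := fun h =>
    hA.eigenvectorBasis.orthonormal.ne_zero i (by ext j; exact congrFun h j)
  have hle := hmin (lam + hA.eigenvalues i) ⟨_, hne, by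
    rw [sub_mulVec, smul_mulVec, one_mulVec, sub_eq_iff_eq_add] at hev
    rw [hev, Complex.ofReal_add, add_smul, add_comm]
    rfl⟩
  simpa using hle

open scoped ComplexOrder in
/-- Rayleigh's principle for the smallest eigenvalue. -/
theorem le_re_star_dotProduct_mulVec {d : ℕ} {J : Matrix (Fin d) (Fin d) ℂ} (hJ : J.IsHermitian)
    {lam : ℝ} (hmin : ∀ mu : ℝ, (∃ w, w ≠ 0 ∧ J *ᵥ w = (mu : ℂ) • w) → lam ≤ mu)
    (w : Fin d → ℂ) (hw : ∑ i, ‖w i‖ ^ 2 = 1) :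
    lam ≤ (star w ⬝ᵥ J *ᵥ w).re ∧
      ((star w ⬝ᵥ J *ᵥ w).re = lam ↔ J *ᵥ w = (lam : ℂ) • w) := by
  have hA := posSemidef_sub_smul_one hJ hmin
  have hpos := hA.dotProduct_mulVec_nonneg w
  have hker := hA.dotProduct_mulVec_zero_iff w
  rw [sub_mulVec, smul_mulVec, one_mulVec, dotProduct_sub, dotProduct_smul,
    star_dotProduct_self, hw, Complex.ofReal_one, smul_eq_mul, mul_one] at hpos hker
  rw [sub_eq_zero, sub_eq_zero] at hker
  obtain ⟨hre, him⟩ := Complex.le_def.1 hpos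
  simp only [Complex.zero_re, Complex.zero_im, Complex.sub_re, Complex.sub_im,
    Complex.ofReal_re, Complex.ofReal_im, sub_zero, sub_nonneg] at hre him
  refine ⟨hre, ?_⟩
  rw [← hker, Complex.ext_iff, Complex.ofReal_re, Complex.ofReal_im]
  exact (and_iff_left him.symm).symm

/-- For unit vectors `z₁, …, z_n ∈ ℂ^(k-1)` and `J = (1/n) Σ z_i z_i*`, if the
smallest eigenvalue of `J` is simple with unit eigenvector `m`, then the maximizers over unit
vectors `u` of the empirical Fréchet function `F_n(u) = (1/n) Σ ‖z_i z_i* − uu*‖_F²` are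
exactly the vectors `c • m` with `‖c‖ = 1`; i.e. the sample VW antimean is `[m]`. -/
theorem stmt2 {k : ℕ} (hk : 3 ≤ k) {n : ℕ} (hn : 0 < n)
    (z : Fin n → Fin (k - 1) → ℂ) (hz : ∀ r, ∑ i, ‖z r i‖ ^ 2 = 1)
    (J : Matrix (Fin (k - 1)) (Fin (k - 1)) ℂ)
    (hJ : J = (n : ℂ)⁻¹ • ∑ r, vwC (z r))
    (lam : ℝ) (m : Fin (k - 1) → ℂ) (hm : ∑ i, ‖m i‖ ^ 2 = 1)
    (hmeig : J.mulVec m = (lam : ℂ) • m)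
    (hmin : ∀ mu : ℝ, (∃ w, w ≠ 0 ∧ J.mulVec w = (mu : ℂ) • w) → lam ≤ mu)
    (hsimple : ∀ w, J.mulVec w = (lam : ℂ) • w → ∃ c : ℂ, w = c • m)
    (Fn : (Fin (k - 1) → ℂ) → ℝ)
    (hFn : ∀ u, Fn u = (n : ℝ)⁻¹ * ∑ r, frobSq (vwC (z r) - vwC u)) :
    ∀ u : Fin (k - 1) → ℂ, (∑ i, ‖u i‖ ^ 2 = 1) →
      ((∀ w : Fin (k - 1) → ℂ, (∑ i, ‖w i‖ ^ 2 = 1) → Fn w ≤ Fn u) ↔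
        ∃ c : ℂ, ‖c‖ = 1 ∧ u = c • m) := by
  intro u hu
  have hherm : J.IsHermitian := by
    rw [hJ]
    ext i j
    simp [Matrix.sum_apply, vwC, vecMulVec_apply, mul_comm]
  have hF : ∀ w : Fin (k - 1) → ℂ, (∑ i, ‖w i‖ ^ 2 = 1) →
      Fn w = 2 - 2 * (star w ⬝ᵥ J *ᵥ w).re := fun w hw => by
    rw [hFn, frechet_eq hn z hz w hw, ← hJ]
  have hray := le_re_star_dotProduct_mulVec hherm hmin
  constructor
  · intro hmax
    have hle := hmax m hm
    rw [hF m hm, hF u hu, (hray m hm).2.2 hmeig] at hle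
    obtain ⟨hlam, hiff⟩ := hray u hu
    obtain ⟨c, rfl⟩ := hsimple u (hiff.1 (by linarith))
    refine ⟨c, ?_, rfl⟩
    simp only [Pi.smul_apply, smul_eq_mul, norm_mul, mul_pow, ← Finset.mul_sum, hm,
      mul_one] at hu
    exact (pow_eq_one_iff_of_nonneg (norm_nonneg c) two_ne_zero).1 hu
  · rintro ⟨c, -, rfl⟩ w hw
    rw [hF w hw, hF _ hu, (hray _ hu).2.2 (by rw [mulVec_smul, hmeig, smul_comm])]
    linarith [(hray w hw).1]
end

section
/- Let A be a Hermitian (k-1)×(k-1) complex matrix. The set of farthest points from A (in Frobenius distance) in the set {zz* : z ∈ ℂ^{k-1}, ‖z‖ = 1} is a single point if and only if the smallest eigenvalue λ₁ of A is simple; in that case the unique farthest point is νν*, where ν is a unit eigenvector of A for λ₁. In particular, a random object Y = [Z] on ℂP^{k-2}, with Z a random vector in ℂ^{k-1} and ‖Z‖ = 1 almost surely, is αVW-nonfocal if and only if the smallest eigenvalue of E[ZZ*] has multiplicity 1. -/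
open MeasureTheory Matrix

/-- The VW-embedded complex projective space: the set of matrices `z z*` with `z` a unit
vector of `ℂⁿ`. -/
def vwSphereC (n : ℕ) : Set (Matrix (Fin n) (Fin n) ℂ) :=
  {P | ∃ z : Fin n → ℂ, (∑ i, ‖z i‖ ^ 2 = 1) ∧ P = vecMulVec z (star z)}

/-- `P` is a farthest point from `A` (in Frobenius distance) on the VW-embedded complex
projective space. -/
def IsFarthestC {n : ℕ} (A P : Matrix (Fin n) (Fin n) ℂ) : Prop :=
  P ∈ vwSphereC n ∧ ∀ Q ∈ vwSphereC n, frobSq (A - Q) ≤ frobSq (A - P)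

/-- `lam` is the smallest eigenvalue of the Hermitian matrix `A` and it is simple. -/
def SmallestEigSimpleC {n : ℕ} (A : Matrix (Fin n) (Fin n) ℂ) (lam : ℝ) : Prop :=
  (∃ v, v ≠ 0 ∧ A.mulVec v = (lam : ℂ) • v) ∧
  (∀ mu : ℝ, (∃ v, v ≠ 0 ∧ A.mulVec v = (mu : ℂ) • v) → lam ≤ mu) ∧
  (∀ v w, v ≠ 0 → A.mulVec v = (lam : ℂ) • v → A.mulVec w = (lam : ℂ) • w → ∃ c : ℂ, w = c • v)

section Farthest

open scoped ComplexOrder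

/-- Multiplying a vector by its conjugate transpose gives the squared Euclidean norm. -/
lemma star_dotProduct_self_eq_sum {n : ℕ} (z : Fin n → ℂ) :
    star z ⬝ᵥ z = ((∑ i, ‖z i‖ ^ 2 : ℝ) : ℂ) := by
  simp [dotProduct, Complex.conj_mul']

lemma frobSq_sub_vecMulVec_star {n : ℕ} (A : Matrix (Fin n) (Fin n) ℂ) {z : Fin n → ℂ}
    (hz : ∑ i, ‖z i‖ ^ 2 = 1) :
    frobSq (A - vecMulVec z (star z)) = frobSq A + 1 - 2 * (star z ⬝ᵥ A *ᵥ z).re := by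
  have hone : ∑ i, ∑ j, ‖z i‖ ^ 2 * ‖z j‖ ^ 2 = 1 := by
    rw [← Finset.sum_mul_sum, hz, one_mul]
  have hform : (star z ⬝ᵥ A *ᵥ z).re
      = ∑ i, ∑ j, (A i j * (starRingEnd ℂ) (z i * star (z j))).re := by
    simp only [dotProduct, mulVec, Finset.mul_sum, Complex.re_sum]
    refine Finset.sum_congr rfl fun i _ => Finset.sum_congr rfl fun j _ => ?_
    congr 1
    simp
    ring
  rw [hform, ← hone]
  simp only [frobSq, Finset.mul_sum, ← Finset.sum_add_distrib, ← Finset.sum_sub_distrib]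
  refine Finset.sum_congr rfl fun i _ => Finset.sum_congr rfl fun j _ => ?_
  rw [Matrix.sub_apply, vecMulVec_apply, Pi.star_apply]
  simp only [← Complex.normSq_eq_norm_sq]
  rw [Complex.normSq_sub, map_mul]
  simp

/-- A Hermitian matrix minus a lower bound of its real eigenvalues is positive semidefinite. -/
lemma Matrix.IsHermitian.posSemidef_sub_smul_one {n : ℕ} {A : Matrix (Fin n) (Fin n) ℂ}
    (hA : A.IsHermitian) {lam : ℝ}
    (hmin : ∀ mu : ℝ, (∃ v, v ≠ 0 ∧ A *ᵥ v = (mu : ℂ) • v) → lam ≤ mu) :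
    (A - (lam : ℂ) • (1 : Matrix (Fin n) (Fin n) ℂ)).PosSemidef := by
  have hB : (A - (lam : ℂ) • (1 : Matrix (Fin n) (Fin n) ℂ)).IsHermitian := by
    refine hA.sub ?_
    simp [IsHermitian, conjTranspose_smul]
  rw [hB.posSemidef_iff_eigenvalues_nonneg]
  intro i
  have hi := hB.mulVec_eigenvectorBasis i
  have hne : (hB.eigenvectorBasis i).ofLp ≠ 0 := fun h =>
    hB.eigenvectorBasis.orthonormal.ne_zero i (by ext j; exact congrFun h j)
  have := hmin (hB.eigenvalues i + lam) ⟨_, hne, by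
    rw [sub_mulVec, smul_mulVec, one_mulVec, sub_eq_iff_eq_add] at hi
    rw [hi]
    push_cast
    rw [add_smul]
    rfl⟩
  simpa using this

lemma star_dotProduct_sub_smul_one_mulVec {n : ℕ} (A : Matrix (Fin n) (Fin n) ℂ) (lam : ℝ)
    {z : Fin n → ℂ} (hz : ∑ i, ‖z i‖ ^ 2 = 1) :
    star z ⬝ᵥ (A - (lam : ℂ) • (1 : Matrix (Fin n) (Fin n) ℂ)) *ᵥ z
      = star z ⬝ᵥ A *ᵥ z - lam := by
  rw [sub_mulVec, smul_mulVec, one_mulVec, dotProduct_sub, dotProduct_smul,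
    star_dotProduct_self_eq_sum, hz]
  simp

lemma exists_unit_smul {n : ℕ} {v : Fin n → ℂ} (hv : v ≠ 0) :
    ∃ c : ℂ, c ≠ 0 ∧ ∑ i, ‖(c • v) i‖ ^ 2 = 1 := by
  have hpos : 0 < ∑ i, ‖v i‖ ^ 2 := by
    obtain ⟨i, hi⟩ := Function.ne_iff.mp hv
    exact Finset.sum_pos' (fun _ _ => by positivity)
      ⟨i, Finset.mem_univ i, by have := norm_pos_iff.mpr hi; positivity⟩
  have hs := Real.sqrt_pos.mpr hpos
  refine ⟨((√(∑ i, ‖v i‖ ^ 2))⁻¹ : ℝ), by exact_mod_cast (inv_pos.mpr hs).ne', ?_⟩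
  simp only [Pi.smul_apply, smul_eq_mul, norm_mul, mul_pow, ← Finset.mul_sum]
  rw [Complex.norm_real, Real.norm_of_nonneg (inv_pos.mpr hs).le, inv_pow,
    Real.sq_sqrt hpos.le, inv_mul_cancel₀ hpos.ne']

variable {n : ℕ} {A : Matrix (Fin n) (Fin n) ℂ} {lam : ℝ}

lemma exists_unit_eigenvector (heig : ∃ v, v ≠ 0 ∧ A *ᵥ v = (lam : ℂ) • v) :
    ∃ z : Fin n → ℂ, ∑ i, ‖z i‖ ^ 2 = 1 ∧ A *ᵥ z = (lam : ℂ) • z := by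
  obtain ⟨v, hv, hAv⟩ := heig
  obtain ⟨c, -, hcv⟩ := exists_unit_smul hv
  exact ⟨c • v, hcv, by rw [mulVec_smul, hAv, smul_comm]⟩

/-- The farthest points are the projections onto unit eigenvectors for the smallest eigenvalue. -/
lemma isFarthestC_iff (hA : A.IsHermitian) (heig : ∃ v, v ≠ 0 ∧ A *ᵥ v = (lam : ℂ) • v)
    (hmin : ∀ mu : ℝ, (∃ v, v ≠ 0 ∧ A *ᵥ v = (mu : ℂ) • v) → lam ≤ mu)
    (P : Matrix (Fin n) (Fin n) ℂ) :
    IsFarthestC A P ↔ ∃ z : Fin n → ℂ, ∑ i, ‖z i‖ ^ 2 = 1 ∧ A *ᵥ z = (lam : ℂ) • z ∧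
      P = vecMulVec z (star z) := by
  have hB := hA.posSemidef_sub_smul_one hmin
  have hform : ∀ z : Fin n → ℂ, ∑ i, ‖z i‖ ^ 2 = 1 → A *ᵥ z = (lam : ℂ) • z →
      (star z ⬝ᵥ A *ᵥ z).re = lam := by
    intro z hz hAz
    rw [hAz, dotProduct_smul, star_dotProduct_self_eq_sum, hz]
    simp
  have hlower : ∀ z : Fin n → ℂ, ∑ i, ‖z i‖ ^ 2 = 1 → lam ≤ (star z ⬝ᵥ A *ᵥ z).re := by
    intro z hz
    have := hB.re_dotProduct_nonneg z
    rw [star_dotProduct_sub_smul_one_mulVec A lam hz] at this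
    simpa using this
  constructor
  · rintro ⟨⟨z, hz, rfl⟩, hfar⟩
    refine ⟨z, hz, ?_, rfl⟩
    obtain ⟨w, hw, hAw⟩ := exists_unit_eigenvector heig
    have hle := hfar _ ⟨w, hw, rfl⟩
    rw [frobSq_sub_vecMulVec_star A hz, frobSq_sub_vecMulVec_star A hw, hform w hw hAw] at hle
    have hzero : star z ⬝ᵥ (A - (lam : ℂ) • (1 : Matrix (Fin n) (Fin n) ℂ)) *ᵥ z = 0 := by
      have hnn := Complex.nonneg_iff.mp (hB.dotProduct_mulVec_nonneg z)
      refine Complex.ext (le_antisymm ?_ hnn.1) hnn.2.symm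
      rw [star_dotProduct_sub_smul_one_mulVec A lam hz]
      simp
      linarith
    rw [hB.dotProduct_mulVec_zero_iff, sub_mulVec, smul_mulVec, one_mulVec, sub_eq_zero] at hzero
    exact hzero
  · rintro ⟨z, hz, hAz, rfl⟩
    refine ⟨⟨z, hz, rfl⟩, ?_⟩
    rintro _ ⟨w, hw, rfl⟩
    rw [frobSq_sub_vecMulVec_star A hz, frobSq_sub_vecMulVec_star A hw, hform z hz hAz]
    linarith [hlower w hw]

lemma SmallestEigSimpleC.vecMulVec_star_eq (h : SmallestEigSimpleC A lam) {v w : Fin n → ℂ}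
    (hv : ∑ i, ‖v i‖ ^ 2 = 1) (hw : ∑ i, ‖w i‖ ^ 2 = 1)
    (hAv : A *ᵥ v = (lam : ℂ) • v) (hAw : A *ᵥ w = (lam : ℂ) • w) :
    vecMulVec w (star w) = vecMulVec v (star v) := by
  have hv0 : v ≠ 0 := by
    rintro rfl
    simp at hv
  obtain ⟨c, rfl⟩ := h.2.2 v w hv0 hAv hAw
  have hc : c * star c = 1 := by
    simp only [Pi.smul_apply, smul_eq_mul, norm_mul, mul_pow, ← Finset.mul_sum, hv,
      mul_one] at hw
    rw [Complex.star_def, Complex.mul_conj']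
    exact_mod_cast hw
  rw [star_smul, smul_vecMulVec, vecMulVec_smul, smul_smul, hc, one_smul]

lemma eq_smul_of_vecMulVec_star_eq {v w : Fin n → ℂ} (hw : ∑ i, ‖w i‖ ^ 2 = 1)
    (h : vecMulVec w (star w) = vecMulVec v (star v)) : w = (star v ⬝ᵥ w) • v := by
  have := congrArg (· *ᵥ w) h
  simpa [vecMulVec_mulVec, star_dotProduct_self_eq_sum, hw] using this

lemma existsUnique_isFarthestC_iff (hA : A.IsHermitian)
    (heig : ∃ v, v ≠ 0 ∧ A *ᵥ v = (lam : ℂ) • v)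
    (hmin : ∀ mu : ℝ, (∃ v, v ≠ 0 ∧ A *ᵥ v = (mu : ℂ) • v) → lam ≤ mu) :
    (∃! P, IsFarthestC A P) ↔ SmallestEigSimpleC A lam := by
  have hfar := isFarthestC_iff hA heig hmin
  constructor
  · intro hP
    refine ⟨heig, hmin, fun v w hv hAv hAw => ?_⟩
    rcases eq_or_ne w 0 with rfl | hw
    · exact ⟨0, by simp⟩
    obtain ⟨a, -, hav⟩ := exists_unit_smul hv
    obtain ⟨b, hb, hbw⟩ := exists_unit_smul hw
    have heq := eq_smul_of_vecMulVec_star_eq hbw <| hP.unique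
      ((hfar _).2 ⟨b • w, hbw, by rw [mulVec_smul, hAw, smul_comm], rfl⟩)
      ((hfar _).2 ⟨a • v, hav, by rw [mulVec_smul, hAv, smul_comm], rfl⟩)
    rw [← eq_inv_smul_iff₀ hb, smul_smul, smul_smul] at heq
    exact ⟨_, heq⟩
  · intro h
    obtain ⟨z, hz, hAz⟩ := exists_unit_eigenvector heig
    refine ⟨_, (hfar _).2 ⟨z, hz, hAz, rfl⟩, fun P hP => ?_⟩
    obtain ⟨w, hw, hAw, rfl⟩ := (hfar P).1 hP
    exact h.vecMulVec_star_eq hz hw hAz hAw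

lemma Matrix.IsHermitian.exists_smallest_eigenvalue [NeZero n] (hA : A.IsHermitian) :
    ∃ lam : ℝ, (∃ v, v ≠ 0 ∧ A *ᵥ v = (lam : ℂ) • v) ∧
      ∀ mu : ℝ, (∃ v, v ≠ 0 ∧ A *ᵥ v = (mu : ℂ) • v) → lam ≤ mu := by
  obtain ⟨i, hi⟩ := Finite.exists_min hA.eigenvalues
  refine ⟨hA.eigenvalues i, ⟨(hA.eigenvectorBasis i).ofLp, fun h =>
    hA.eigenvectorBasis.orthonormal.ne_zero i (by ext j; exact congrFun h j),
    hA.mulVec_eigenvectorBasis i⟩, ?_⟩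
  rintro mu ⟨v, hv, hAv⟩
  have hspec : mu ∈ spectrum ℝ A := by
    rw [← spectrum.algebraMap_mem_iff ℂ, ← Matrix.spectrum_toLin']
    exact (Module.End.hasEigenvalue_of_hasEigenvector (x := v)
      ⟨Module.End.mem_eigenspace_iff.2 hAv, hv⟩).mem_spectrum
  rw [hA.spectrum_real_eq_range_eigenvalues] at hspec
  obtain ⟨j, rfl⟩ := hspec
  exact hi j

end Farthest

/-- For a Hermitian `(k-1)×(k-1)` matrix `A` with smallest eigenvalue `lam`, the
set of farthest points from `A` on `{zz* : ‖z‖ = 1}` is a single point iff `lam` is simple, in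
which case the unique farthest point is `νν*` for `ν` a unit eigenvector of `lam`.  In
particular, a random object `Y = [Z]` on `ℂP^(k-2)` with `‖Z‖ = 1` a.s. is αVW-nonfocal
(i.e. `E[ZZ*]` has a unique farthest point on the embedded projective space) iff the smallest
eigenvalue of `E[ZZ*]` has multiplicity 1. -/
theorem stmt8 {k : ℕ} (hk : 3 ≤ k) (A : Matrix (Fin (k - 1)) (Fin (k - 1)) ℂ)
    (hA : A.IsHermitian)
    (lam : ℝ)
    (hlameig : ∃ v, v ≠ 0 ∧ A.mulVec v = (lam : ℂ) • v)
    (hlammin : ∀ mu : ℝ, (∃ v, v ≠ 0 ∧ A.mulVec v = (mu : ℂ) • v) → lam ≤ mu)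
    {Ω : Type*} [MeasurableSpace Ω] (μ : Measure Ω) [IsProbabilityMeasure μ]
    (Z : Ω → Fin (k - 1) → ℂ) (hZm : Measurable Z)
    (hZ : ∀ᵐ ω ∂μ, ∑ i, ‖Z ω i‖ ^ 2 = 1)
    (M : Matrix (Fin (k - 1)) (Fin (k - 1)) ℂ)
    (hM : ∀ i j, M i j = ∫ ω, Z ω i * (starRingEnd ℂ) (Z ω j) ∂μ) :
    ((∃! P, IsFarthestC A P) ↔ SmallestEigSimpleC A lam)
    ∧
    (∀ ν : Fin (k - 1) → ℂ, (∑ i, ‖ν i‖ ^ 2 = 1) → A.mulVec ν = (lam : ℂ) • ν →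
      SmallestEigSimpleC A lam →
      IsFarthestC A (vecMulVec ν (star ν)) ∧ ∀ P, IsFarthestC A P → P = vecMulVec ν (star ν))
    ∧
    ((∃! P, IsFarthestC M P) ↔ ∃ mu : ℝ, SmallestEigSimpleC M mu) := by
  refine ⟨existsUnique_isFarthestC_iff hA hlameig hlammin, fun ν hν hAν hsimple => ?_, ?_⟩
  · have hfar := isFarthestC_iff hA hlameig hlammin
    refine ⟨(hfar _).2 ⟨ν, hν, hAν, rfl⟩, fun P hP => ?_⟩
    obtain ⟨w, hw, hAw, rfl⟩ := (hfar P).1 hP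
    exact hsimple.vecMulVec_star_eq hν hw hAν hAw
  · have hMherm : M.IsHermitian := by
      ext i j
      rw [conjTranspose_apply, hM, hM, Complex.star_def, ← integral_conj]
      refine integral_congr_ae (.of_forall fun ω => ?_)
      simp [mul_comm]
    have : NeZero (k - 1) := ⟨by omega⟩
    constructor
    · intro h
      obtain ⟨mu, heig, hmin⟩ := hMherm.exists_smallest_eigenvalue
      exact ⟨mu, (existsUnique_isFarthestC_iff hMherm heig hmin).1 h⟩
    · rintro ⟨mu, h⟩
      exact (existsUnique_isFarthestC_iff hMherm h.1 h.2.1).2 h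
end
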